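/- The linear map from V to ℝ × {γ ∈ V* : γ(ξ) = 0} sending X to (α(X), ι_X ω) is a linear isomorphism. Consequently, for every h ∈ ℝ and every β ∈ V* there exists a unique X ∈ V with α(X) = h and ι_X ω = β(ξ)α − β. (This is the pointwise model of the one-to-one correspondence between smooth functions H and contact vector fields X_H, determined by η(X_H) = H and ι_{X_H} dη = dH(ξ)η − dH.) -/

import Mathlib

/-- The `(2n+1)`-fold alternating form `α ∧ ωⁿ` (up to a nonzero normalization
constant), given by full antisymmetrization of `α ⊗ ω ⊗ ⋯ ⊗ ω`. -/
noncomputable def contactWedge {V : Type*} [AddCommGroup V] [Module ℝ V] (n : ℕ)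
    (α : V →ₗ[ℝ] ℝ) (ω : V →ₗ[ℝ] V →ₗ[ℝ] ℝ) (v : Fin (2 * n + 1) → V) : ℝ :=
  ∑ σ : Equiv.Perm (Fin (2 * n + 1)),
    ((Equiv.Perm.sign σ : ℤ) : ℝ) * (α (v (σ 0)) *
      ∏ i : Fin n, ω (v (σ ⟨2 * i.val + 1, by have := i.isLt; omega⟩))
        (v (σ ⟨2 * i.val + 2, by have := i.isLt; omega⟩)))

noncomputable def cwTerm {V : Type*} [AddCommGroup V] [Module ℝ V] (n : ℕ)
    (α : V →ₗ[ℝ] ℝ) (ω : V →ₗ[ℝ] V →ₗ[ℝ] ℝ) (v : Fin (2 * n + 1) → V) : ℝ :=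
  α (v 0) * ∏ i : Fin n, ω (v ⟨2 * i.val + 1, by have := i.isLt; omega⟩)
        (v ⟨2 * i.val + 2, by have := i.isLt; omega⟩)

theorem fin_cases_cw (n : ℕ) (j : Fin (2 * n + 1)) :
    j = 0 ∨ (∃ k : Fin n, j = ⟨2 * k.val + 1, by have := k.isLt; omega⟩) ∨
      ∃ k : Fin n, j = ⟨2 * k.val + 2, by have := k.isLt; omega⟩ := by
  obtain ⟨j, hj⟩ := j
  by_cases h0 : j = 0
  · left; ext; simp [h0]
  right
  by_cases h1 : j % 2 = 1
  · left; exact ⟨⟨j / 2, by omega⟩, by ext; simp; omega⟩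
  · right; exact ⟨⟨j / 2 - 1, by omega⟩, by ext; simp; omega⟩

theorem cwTerm_linear {V : Type*} [AddCommGroup V] [Module ℝ V] (n : ℕ)
    (α : V →ₗ[ℝ] ℝ) (ω : V →ₗ[ℝ] V →ₗ[ℝ] ℝ) (v : Fin (2 * n + 1) → V)
    (j : Fin (2 * n + 1)) :
    ∃ L : V →ₗ[ℝ] ℝ, ∀ x, cwTerm n α ω (Function.update v j x) = L x := by
  rcases fin_cases_cw n j with h | ⟨k, h⟩ | ⟨k, h⟩
  · refine ⟨(∏ i : Fin n, ω (v ⟨2 * i.val + 1, by have := i.isLt; omega⟩)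
        (v ⟨2 * i.val + 2, by have := i.isLt; omega⟩)) • α, fun x => ?_⟩
    subst h
    simp [cwTerm, Function.update_apply, Fin.ext_iff, mul_comm]
  · refine ⟨(α (v 0) * ∏ i ∈ Finset.univ.erase k,
        ω (v ⟨2 * i.val + 1, by have := i.isLt; omega⟩)
        (v ⟨2 * i.val + 2, by have := i.isLt; omega⟩)) •
        ω.flip (v ⟨2 * k.val + 2, by have := k.isLt; omega⟩), fun x => ?_⟩
    subst h
    rw [cwTerm, ← Finset.mul_prod_erase _ _ (Finset.mem_univ k)]
    rw [Finset.prod_congr rfl (g := fun i : Fin n =>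
        ω (v ⟨2 * i.val + 1, by have := i.isLt; omega⟩)
        (v ⟨2 * i.val + 2, by have := i.isLt; omega⟩))]
    · simp [Function.update_apply, Fin.ext_iff]
      ring
    · intro i hi
      have h1 : i.val ≠ k.val := fun h => (Finset.ne_of_mem_erase hi) (Fin.ext h)
      have h2 : 2 * i.val + 2 ≠ 2 * k.val + 1 := by omega
      simp [Function.update_apply, Fin.ext_iff, h1]
      rw [if_neg (by omega)]
  · refine ⟨(α (v 0) * ∏ i ∈ Finset.univ.erase k,
        ω (v ⟨2 * i.val + 1, by have := i.isLt; omega⟩)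
        (v ⟨2 * i.val + 2, by have := i.isLt; omega⟩)) •
        ω (v ⟨2 * k.val + 1, by have := k.isLt; omega⟩), fun x => ?_⟩
    subst h
    rw [cwTerm, ← Finset.mul_prod_erase _ _ (Finset.mem_univ k)]
    rw [Finset.prod_congr rfl (g := fun i : Fin n =>
        ω (v ⟨2 * i.val + 1, by have := i.isLt; omega⟩)
        (v ⟨2 * i.val + 2, by have := i.isLt; omega⟩))]
    · simp [Function.update_apply, Fin.ext_iff]
      ring
    · intro i hi
      have h1 : i.val ≠ k.val := fun h => (Finset.ne_of_mem_erase hi) (Fin.ext h)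
      have h2 : 2 * i.val + 1 ≠ 2 * k.val + 2 := by omega
      simp [Function.update_apply, Fin.ext_iff, h1]
      rw [if_neg (by omega)]

theorem cwTerm_zero {V : Type*} [AddCommGroup V] [Module ℝ V] (n : ℕ)
    (α : V →ₗ[ℝ] ℝ) (ω : V →ₗ[ℝ] V →ₗ[ℝ] ℝ) (v : Fin (2 * n + 1) → V)
    (j : Fin (2 * n + 1)) (h1 : α (v j) = 0) (h2 : ∀ Y, ω (v j) Y = 0)
    (h3 : ∀ Y, ω Y (v j) = 0) : cwTerm n α ω v = 0 := by
  rcases fin_cases_cw n j with h | ⟨k, h⟩ | ⟨k, h⟩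
  · subst h; simp [cwTerm, h1]
  · subst h
    rw [cwTerm, Finset.prod_eq_zero (Finset.mem_univ k) (h2 _), mul_zero]
  · subst h
    rw [cwTerm, Finset.prod_eq_zero (Finset.mem_univ k) (h3 _), mul_zero]

noncomputable def cwMulti {V : Type*} [AddCommGroup V] [Module ℝ V] (n : ℕ)
    (α : V →ₗ[ℝ] ℝ) (ω : V →ₗ[ℝ] V →ₗ[ℝ] ℝ) :
    MultilinearMap ℝ (fun _ : Fin (2 * n + 1) => V) ℝ :=
  MultilinearMap.mk' (cwTerm n α ω)
    (fun v j x y => by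
      obtain ⟨L, hL⟩ := cwTerm_linear n α ω v j
      simp only [hL, map_add])
    (fun v j c x => by
      obtain ⟨L, hL⟩ := cwTerm_linear n α ω v j
      simp only [hL, map_smul])

theorem cw_eq {V : Type*} [AddCommGroup V] [Module ℝ V] (n : ℕ)
    (α : V →ₗ[ℝ] ℝ) (ω : V →ₗ[ℝ] V →ₗ[ℝ] ℝ) (v : Fin (2 * n + 1) → V) :
    contactWedge n α ω v = MultilinearMap.alternatization (cwMulti n α ω) v := by
  rw [MultilinearMap.alternatization_apply, contactWedge]
  refine Finset.sum_congr rfl fun σ _ => ?_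
  rw [Units.smul_def, zsmul_eq_mul]
  rfl

theorem cw_ker {V : Type*} [AddCommGroup V] [Module ℝ V] [FiniteDimensional ℝ V]
    (n : ℕ) (hdim : Module.finrank ℝ V = 2 * n + 1)
    (α : V →ₗ[ℝ] ℝ) (ω : V →ₗ[ℝ] V →ₗ[ℝ] ℝ)
    (hcontact : ∃ v, contactWedge n α ω v ≠ 0)
    (X : V) (h1 : α X = 0) (h2 : ∀ Y, ω X Y = 0) (h3 : ∀ Y, ω Y X = 0) : X = 0 := by
  obtain ⟨v, hv⟩ := hcontact
  have hz : ∀ j, contactWedge n α ω (Function.update v j X) = 0 := by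
    intro j
    refine Finset.sum_eq_zero fun σ _ => ?_
    have := cwTerm_zero n α ω (fun i => Function.update v j X (σ i)) (σ.symm j)
      (by simpa using h1) (by simpa using h2) (by simpa using h3)
    rw [cwTerm] at this
    rw [this, mul_zero]
  simp only [cw_eq] at hv hz
  set f := MultilinearMap.alternatization (cwMulti n α ω)
  have hli : LinearIndependent ℝ v := by
    by_contra h
    exact hv (f.map_linearDependent v h)
  have hs := hli.span_eq_top_of_card_eq_finrank' (by simp [hdim])
  obtain ⟨c, hc⟩ := (Submodule.mem_span_range_iff_exists_fun ℝ).1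
    (hs ▸ Submodule.mem_top : X ∈ Submodule.span ℝ (Set.range v))
  have hc0 : ∀ j, c j = 0 := by
    intro j
    have h := hz j
    rw [← hc, f.map_update_sum, Finset.sum_eq_single j] at h
    · simpa [f.map_update_smul, hv] using h
    · intro i _ hij
      rw [f.map_update_smul, f.map_update_self _ hij.symm, smul_zero]
    · simp
  rw [← hc]
  simp [hc0]

/-- The linear map `V → ℝ × {γ ∈ V* : γ ξ = 0}`,
`X ↦ (α X, ι_X ω)`, is a linear isomorphism (it is injective and its range is
exactly the set of pairs `(h, γ)` with `γ ξ = 0`).  Consequently, for every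
`h ∈ ℝ` and every `β ∈ V*` there is a unique `X ∈ V` with `α X = h` and
`ι_X ω = β(ξ) α − β`. -/
theorem statement_2 {V : Type*} [AddCommGroup V] [Module ℝ V] [FiniteDimensional ℝ V]
    (n : ℕ) (hn : 1 ≤ n) (hdim : Module.finrank ℝ V = 2 * n + 1)
    (α : V →ₗ[ℝ] ℝ) (ω : V →ₗ[ℝ] V →ₗ[ℝ] ℝ) (hω : ∀ x, ω x x = 0)
    (hcontact : ∃ v, contactWedge n α ω v ≠ 0)
    (ξ : V) (hξ1 : α ξ = 1) (hξ2 : ∀ Y, ω ξ Y = 0) :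
    (Function.Injective (LinearMap.prod α ω) ∧
      Set.range (LinearMap.prod α ω) = {p : ℝ × (V →ₗ[ℝ] ℝ) | p.2 ξ = 0}) ∧
    ∀ (h : ℝ) (β : V →ₗ[ℝ] ℝ), ∃! X : V, α X = h ∧ ω X = β ξ • α - β := by
  have hskew : ∀ x y, ω x y = - ω y x := by
    intro x y
    have := hω (x + y)
    simp [hω] at this
    linarith
  have hinj : Function.Injective (LinearMap.prod α ω) := by
    rw [injective_iff_map_eq_zero]
    intro X hX
    have h1 : α X = 0 := congrArg Prod.fst hX
    have h2 : ω X = 0 := congrArg Prod.snd hX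
    exact cw_ker n hdim α ω hcontact X h1 (by simp [h2])
      (fun Y => by rw [hskew, h2]; simp)
  let E : (ℝ × (V →ₗ[ℝ] ℝ)) →ₗ[ℝ] ℝ :=
    (LinearMap.applyₗ ξ).comp (LinearMap.snd ℝ ℝ (V →ₗ[ℝ] ℝ))
  have hE : ∀ p, E p = p.2 ξ := fun p => rfl
  have hsurj : Function.Surjective E := fun c => ⟨(0, c • α), by simp [hE, hξ1]⟩
  have hle : LinearMap.range (LinearMap.prod α ω) ≤ LinearMap.ker E := by
    rintro _ ⟨X, rfl⟩
    rw [LinearMap.mem_ker, hE]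
    change ω X ξ = 0
    rw [hskew, hξ2, neg_zero]
  have heq : LinearMap.range (LinearMap.prod α ω) = LinearMap.ker E := by
    apply Submodule.eq_of_le_of_finrank_eq hle
    rw [LinearMap.finrank_range_of_inj hinj]
    have h1 := E.finrank_range_add_finrank_ker
    rw [LinearMap.range_eq_top.2 hsurj, finrank_top, Module.finrank_prod] at h1
    have h2 : Module.finrank ℝ (V →ₗ[ℝ] ℝ) = Module.finrank ℝ V := Subspace.dual_finrank_eq
    rw [h2, Module.finrank_self] at h1
    omega
  have hmem : ∀ p : ℝ × (V →ₗ[ℝ] ℝ), p ∈ Set.range (LinearMap.prod α ω) ↔ p.2 ξ = 0 := by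
    intro p
    rw [← hE, ← LinearMap.mem_ker, ← heq]
    rfl
  refine ⟨⟨hinj, Set.ext hmem⟩, fun h β => ?_⟩
  obtain ⟨X, hX⟩ := (hmem (h, β ξ • α - β)).2 (by simp [hξ1])
  refine ⟨X, ⟨congrArg Prod.fst hX, congrArg Prod.snd hX⟩, fun Y hY => hinj ?_⟩
  rw [hX]
  exact Prod.ext hY.1 hY.2
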